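/- Let ε ∈ (0,2^{-e}) and η > 0, and set k_η := max( 2 + 2·log₂(1/η), (d_M/2)·log₂(d_M/(2ε²)) + d_M·log₂log₂(d_M/(2ε²)) ). Then for every λ∞ ≥ 4^{k_η/d_M} and every p ∈ M, the truncation error of the heat kernel satisfies ‖H_p(·, ε²) − H^{λ∞}_p(·, ε²)‖²_{L²(M,σ^M)} ≤ C_M η². -/

import Mathlib

open MeasureTheory Metric Real
open scoped ENNReal NNReal

/-- The orthogonal projection `H^{λ∞}_p(x,t) = Σ_{λ ≤ λ∞} e^{−λt} Σ_j φ_{λ,j}(p) φ_{λ,j}(x)`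
of the heat kernel onto `E_{λ∞}(M) = ⊕_{λ ≤ λ∞} H_λ`, expressed through the eigenvalues
`lam i` of `−Δ_M`, the eigenspace dimensions `ddim i`, and orthonormal bases
`efn i j` of the eigenspaces. -/
noncomputable def truncatedHeatKernel {M : Type*} (lam : ℕ → ℝ) (ddim : ℕ → ℕ)
    (efn : (i : ℕ) → Fin (ddim i) → M → ℝ) (Λ : ℝ) (p x : M) (t : ℝ) : ℝ :=
  ∑' i : ℕ, if lam i ≤ Λ then Real.exp (-lam i * t) * ∑ j, efn i j p * efn i j x else 0

/-- Growth: `log u ≤ u / a` for `u ≥ a L²`. -/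
lemma aux_log_le (a L u : ℝ) (ha : 0 < a) (hL : 2 ≤ L) (haL : Real.log a = L * Real.log 2)
    (hu : a * L ^ 2 ≤ u) : Real.log u ≤ u / a := by
  have hv : L ^ 2 ≤ u / a := by rw [le_div_iff₀ ha]; linarith
  set v := u / a with hvdef
  have hvpos : 0 < v := by nlinarith
  have huv : u = a * v := by rw [hvdef]; field_simp
  rw [huv, Real.log_mul ha.ne' hvpos.ne', haL]
  have h1 : Real.log (v / 2) ≤ v / 2 - 1 := Real.log_le_sub_one_of_pos (by positivity)
  rw [Real.log_div hvpos.ne' (by norm_num)] at h1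
  have h2 : Real.log 2 < 0.6931471808 := Real.log_two_lt_d9
  have h3 : L * Real.log 2 ≤ L * 1 := by
    apply mul_le_mul_of_nonneg_left <;> linarith
  nlinarith

lemma aux_numeric (d : ℕ) (hd : 1 ≤ d) (ε : ℝ) (hε : 0 < ε)
    (hε2 : ε < (2 : ℝ) ^ (-(Real.exp 1))) (η : ℝ) (hη : 0 < η) (Λ : ℝ)
    (hΛ : (4 : ℝ) ^ (max (2 + 2 * Real.logb 2 (1 / η))
            (((d : ℝ) / 2) * Real.logb 2 ((d : ℝ) / (2 * ε ^ 2))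
              + (d : ℝ) * Real.logb 2 (Real.logb 2 ((d : ℝ) / (2 * ε ^ 2)))) / (d : ℝ))
          ≤ Λ) :
    0 < Λ ∧ 4 / η ^ 2 ≤ Λ ^ ((d : ℝ) / 2) ∧
      ∀ u, Λ ≤ u → u ^ (d : ℝ) ≤ Real.exp (2 * ε ^ 2 * u) := by
  have hd1 : (1 : ℝ) ≤ d := by exact_mod_cast hd
  have hd0 : (0 : ℝ) < d := by linarith
  have hpos : 0 < Λ := lt_of_lt_of_le (by positivity) hΛ
  set A := 2 + 2 * Real.logb 2 (1 / η) with hA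
  set a := (d : ℝ) / (2 * ε ^ 2) with ha
  set L := Real.logb 2 a with hL
  set B := ((d : ℝ) / 2) * L + (d : ℝ) * Real.logb 2 L with hB
  have ha0 : 0 < a := by positivity
  have hA' : (4 : ℝ) ^ (A / d) ≤ Λ := le_trans (Real.rpow_le_rpow_of_exponent_le (by norm_num)
    (by gcongr; exact le_max_left _ _)) hΛ
  have hB' : (4 : ℝ) ^ (B / d) ≤ Λ := le_trans (Real.rpow_le_rpow_of_exponent_le (by norm_num)
    (by gcongr; exact le_max_right _ _)) hΛ
  have h4 : (4 : ℝ) = 2 ^ (2 : ℝ) := by norm_num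
  refine ⟨hpos, ?_, ?_⟩
  · have h1 : ((4 : ℝ) ^ (A / d)) ^ ((d : ℝ) / 2) ≤ Λ ^ ((d : ℝ) / 2) :=
      Real.rpow_le_rpow (by positivity) hA' (by positivity)
    refine le_trans (le_of_eq ?_) h1
    rw [h4, ← Real.rpow_mul (by norm_num), ← Real.rpow_mul (by norm_num)]
    have : 2 * (A / d * ((d : ℝ) / 2)) = 2 + Real.logb 2 (1 / η) * 2 := by
      rw [hA]; field_simp
    rw [this, Real.rpow_add (by norm_num), Real.rpow_mul (by norm_num),
      Real.rpow_logb (by norm_num) (by norm_num) (by positivity)]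
    norm_num
    field_simp
  · intro u hu
    have hu0 : 0 < u := lt_of_lt_of_le hpos hu
    have he2 : ε ^ 2 ≤ 1 / 16 := by
      have h1 : (2 : ℝ) ^ (-(Real.exp 1)) ≤ (2 : ℝ) ^ (-(2 : ℝ)) := by
        apply Real.rpow_le_rpow_of_exponent_le (by norm_num)
        have := Real.exp_one_gt_d9
        linarith
      have h2 : (2 : ℝ) ^ (-(2 : ℝ)) = 1 / 4 := by
        rw [Real.rpow_neg (by norm_num)]; norm_num
      have h3 : ε ≤ 1 / 4 := by rw [← h2]; exact hε2.le.trans h1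
      nlinarith
    have ha4 : 4 ≤ a := by
      rw [ha, le_div_iff₀ (by positivity)]; nlinarith
    have hL2 : 2 ≤ L := by
      rw [hL, Real.le_logb_iff_rpow_le (by norm_num) ha0]; norm_num; exact ha4
    have hu' : a * L ^ 2 ≤ u := by
      refine le_trans (le_of_eq ?_) (le_trans hB' hu)
      rw [h4, ← Real.rpow_mul (by norm_num)]
      have : 2 * (B / d) = L + Real.logb 2 L * 2 := by
        rw [hB]; field_simp
      rw [this, Real.rpow_add (by norm_num), Real.rpow_mul (by norm_num),
        Real.rpow_logb (by norm_num) (by norm_num) ha0,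
        Real.rpow_logb (by norm_num) (by norm_num) (by linarith)]
      norm_num
    have haL : Real.log a = L * Real.log 2 := by
      rw [hL, Real.logb]; field_simp
    have := aux_log_le a L u ha0 hL2 haL hu'
    rw [Real.rpow_def_of_pos hu0]
    apply Real.exp_le_exp.mpr
    have h5 : u / a * d = 2 * ε ^ 2 * u := by
      rw [ha]; field_simp
    rw [← h5]
    gcongr

/-- Window summation. -/
lemma aux_windows (d : ℕ) (hd : 1 ≤ d) (C t η Λ : ℝ) (hC : 0 < C) (ht : 0 < t) (hη : 0 < η)
    (lam : ℕ → ℝ) (ddim : ℕ → ℕ)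
    (hsum : Summable fun i => Real.exp (-lam i * t) * (ddim i : ℝ))
    (hWeyl : ∀ Λ : ℝ, 0 < Λ →
      (∑' i : ℕ, if Λ < lam i ∧ lam i ≤ (4 : ℝ) ^ ((1 : ℝ) / (d : ℝ)) * Λ
        then (ddim i : ℝ) else 0) ≤ C * Λ ^ ((d : ℝ) / 2))
    (hpos : 0 < Λ) (h1 : 4 / η ^ 2 ≤ Λ ^ ((d : ℝ) / 2))
    (h2 : ∀ u, Λ ≤ u → u ^ (d : ℝ) ≤ Real.exp (2 * t * u)) (F : Finset ℕ) :
    (∑ i ∈ F, if Λ < lam i then Real.exp (-lam i * t) ^ 2 * (ddim i : ℝ) else 0)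
      ≤ C * η ^ 2 := by
  have hd1 : (1 : ℝ) ≤ d := by exact_mod_cast hd
  have hd0 : (0 : ℝ) < d := by linarith
  set q := (4 : ℝ) ^ ((1 : ℝ) / (d : ℝ)) with hq
  have hq1 : 1 < q := Real.one_lt_rpow (by norm_num) (by positivity)
  have hq0 : 0 < q := by linarith
  have hqd : q ^ ((d : ℝ) / 2) = 2 := by
    rw [hq, ← Real.rpow_mul (by norm_num)]
    have : 1 / (d : ℝ) * (d / 2) = 1 / 2 := by field_simp
    rw [this, ← Real.sqrt_eq_rpow]
    rw [show (4 : ℝ) = 2 ^ 2 by norm_num]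
    simp
  -- one window
  have hwin : ∀ u : ℝ, 0 < u → (∑ i ∈ F, if u < lam i ∧ lam i ≤ q * u then
      Real.exp (-lam i * t) ^ 2 * (ddim i : ℝ) else 0)
      ≤ Real.exp (- (2 * t * u)) * (C * u ^ ((d : ℝ) / 2)) := by
    intro u hu
    have hs : Summable fun i : ℕ => if u < lam i ∧ lam i ≤ q * u then (ddim i : ℝ) else 0 := by
      refine Summable.of_nonneg_of_le (fun i => by positivity) (fun i => ?_)
        (hsum.mul_left (Real.exp (q * u * t)))
      split_ifs with h
      · rw [← mul_assoc, ← Real.exp_add]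
        apply le_mul_of_one_le_left (by positivity)
        apply Real.one_le_exp
        nlinarith [h.2]
      · positivity
    calc _ ≤ ∑ i ∈ F, Real.exp (- (2 * t * u)) *
          (if u < lam i ∧ lam i ≤ q * u then (ddim i : ℝ) else 0) := by
          apply Finset.sum_le_sum
          intro i _
          split_ifs with h
          · rw [← Real.exp_nat_mul]
            gcongr
            push_cast
            nlinarith [h.1]
          · simp
      _ = Real.exp (- (2 * t * u)) *
          ∑ i ∈ F, (if u < lam i ∧ lam i ≤ q * u then (ddim i : ℝ) else 0) := by
          rw [Finset.mul_sum]
      _ ≤ _ := by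
          gcongr
          refine le_trans (hs.sum_le_tsum F (fun i _ => by positivity)) (hWeyl u hu)
  have hterm : ∀ m : ℕ, Real.exp (- (2 * t * (q ^ m * Λ))) * (C * (q ^ m * Λ) ^ ((d : ℝ) / 2))
      ≤ C * η ^ 2 / 4 * (1 / 2) ^ m := by
    intro m
    have hqm : 1 ≤ q ^ m := one_le_pow₀ hq1.le
    have hu : Λ ≤ q ^ m * Λ := by nlinarith
    have hE := h2 _ hu
    have hu0 : 0 < q ^ m * Λ := by positivity
    have hX : (q ^ m * Λ) ^ ((d : ℝ) / 2) = 2 ^ m * Λ ^ ((d : ℝ) / 2) := by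
      rw [Real.mul_rpow (by positivity) hpos.le, ← Real.rpow_natCast q m, ← Real.rpow_mul hq0.le,
        mul_comm (m : ℝ), Real.rpow_mul hq0.le, hqd, Real.rpow_natCast]
    have hXX : (q ^ m * Λ) ^ (d : ℝ) = ((q ^ m * Λ) ^ ((d : ℝ) / 2)) ^ 2 := by
      rw [← Real.rpow_natCast (_ ^ ((d : ℝ) / 2)), ← Real.rpow_mul hu0.le]; norm_num
    rw [hXX] at hE
    rw [hX] at hE ⊢
    set Y := Λ ^ ((d : ℝ) / 2) with hY
    have hY0 : 0 < Y := by positivity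
    rw [Real.exp_neg]
    have hE' : (Real.exp (2 * t * (q ^ m * Λ)))⁻¹ ≤ ((2 ^ m * Y) ^ 2)⁻¹ := by
      gcongr
    calc _ ≤ ((2 ^ m * Y) ^ 2)⁻¹ * (C * (2 ^ m * Y)) := by gcongr
      _ = C * Y⁻¹ * (1 / 2) ^ m := by
          rw [one_div, inv_pow]; field_simp
      _ ≤ C * (4 / η ^ 2)⁻¹ * (1 / 2) ^ m := by gcongr
      _ = _ := by field_simp
  have hind : ∀ N : ℕ, (∑ i ∈ F, if Λ < lam i ∧ lam i ≤ q ^ N * Λ then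
      Real.exp (-lam i * t) ^ 2 * (ddim i : ℝ) else 0)
      ≤ C * η ^ 2 / 4 * (2 - 2 * (1 / 2) ^ N) := by
    intro N
    induction N with
    | zero =>
      simp only [pow_zero, one_mul]
      rw [Finset.sum_eq_zero]
      · norm_num
      · intro i _
        rw [if_neg]
        rintro ⟨h, h'⟩
        linarith
    | succ N ih =>
      have := (hwin (q ^ N * Λ) (by positivity)).trans (hterm N)
      have hsplit : (∑ i ∈ F, if Λ < lam i ∧ lam i ≤ q ^ (N + 1) * Λ then
          Real.exp (-lam i * t) ^ 2 * (ddim i : ℝ) else 0) ≤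
          (∑ i ∈ F, if Λ < lam i ∧ lam i ≤ q ^ N * Λ then
            Real.exp (-lam i * t) ^ 2 * (ddim i : ℝ) else 0) +
          (∑ i ∈ F, if q ^ N * Λ < lam i ∧ lam i ≤ q * (q ^ N * Λ) then
            Real.exp (-lam i * t) ^ 2 * (ddim i : ℝ) else 0) := by
        rw [← Finset.sum_add_distrib]
        apply Finset.sum_le_sum
        intro i _
        have hnn : 0 ≤ Real.exp (-lam i * t) ^ 2 * (ddim i : ℝ) := by positivity
        have e : q ^ (N + 1) * Λ = q * (q ^ N * Λ) := by ring
        rw [e]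
        by_cases hh : lam i ≤ q ^ N * Λ
        · split_ifs <;> first | linarith | tauto
        · have : q ^ N * Λ < lam i := not_le.mp hh
          split_ifs <;> first | linarith | tauto
      have e2 : C * η ^ 2 / 4 * (2 - 2 * (1 / 2) ^ (N + 1)) =
        C * η ^ 2 / 4 * (2 - 2 * (1 / 2) ^ N) + C * η ^ 2 / 4 * (1 / 2) ^ N := by
        rw [pow_succ]; ring
      rw [e2]
      linarith
  obtain ⟨N, hN⟩ : ∃ N : ℕ, ∀ i ∈ F, lam i ≤ q ^ N * Λ := by
    have ht : Filter.Tendsto (fun N : ℕ => q ^ N * Λ) Filter.atTop Filter.atTop :=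
      (tendsto_pow_atTop_atTop_of_one_lt hq1).atTop_mul_const hpos
    have : ∀ᶠ N : ℕ in Filter.atTop, ∀ i ∈ F, lam i ≤ q ^ N * Λ := by
      rw [Filter.eventually_all_finset]
      intro i _
      exact ht.eventually_ge_atTop (lam i)
    exact this.exists
  have h3 := hind N
  have h4 : (∑ i ∈ F, if Λ < lam i then Real.exp (-lam i * t) ^ 2 * (ddim i : ℝ) else 0) =
      (∑ i ∈ F, if Λ < lam i ∧ lam i ≤ q ^ N * Λ then
      Real.exp (-lam i * t) ^ 2 * (ddim i : ℝ) else 0) := by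
    apply Finset.sum_congr rfl
    intro i hi
    simp [hN i hi]
  rw [h4]
  refine h3.trans ?_
  have : (0 : ℝ) < (1 / 2) ^ N := by positivity
  have h6 : 0 < C * η ^ 2 := by positivity
  nlinarith

/-- Measurability of the zonal functions. -/
lemma aux_zonal_meas {M : Type*} [MeasurableSpace M] (μ : Measure M)
    (lam : ℕ → ℝ) (hmono : StrictMono lam) (P : ℕ → M → ℝ) (h : M → ℝ → ℝ)
    (hm : ∀ t, 0 < t → AEStronglyMeasurable (fun x => h x t) μ)
    (hexp : ∀ x t, 0 < t → HasSum (fun i => Real.exp (-lam i * t) * P i x) (h x t)) (n : ℕ) :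
    AEStronglyMeasurable (P n) μ := by
  induction n using Nat.strong_induction_on with
  | _ n ih =>
  refine aestronglyMeasurable_of_tendsto_ae (u := Filter.atTop)
    (f := fun (k : ℕ) x => Real.exp (lam n * ((k : ℝ) + 1)) *
      (h x ((k : ℝ) + 1) - ∑ i ∈ Finset.range n, Real.exp (-lam i * ((k : ℝ) + 1)) * P i x))
    ?_ ?_
  · intro k
    refine AEStronglyMeasurable.const_mul ((hm _ (by positivity)).sub ?_) _
    refine Finset.aestronglyMeasurable_fun_sum _ (fun i hi => ?_)
    exact (ih i (Finset.mem_range.mp hi)).const_mul _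
  · refine Filter.Eventually.of_forall (fun x => ?_)
    have hs1 := (hexp x 1 one_pos).summable
    have key : ∀ k : ℕ, Real.exp (lam n * ((k : ℝ) + 1)) *
      (h x ((k : ℝ) + 1) - ∑ i ∈ Finset.range n, Real.exp (-lam i * ((k : ℝ) + 1)) * P i x)
      = ∑' i, Real.exp (-(lam (i + n) - lam n) * ((k : ℝ) + 1)) * P (i + n) x := by
      intro k
      have hh := hexp x ((k : ℝ) + 1) (by positivity)
      have := (hasSum_nat_add_iff' n).mpr hh
      rw [← (this.mul_left (Real.exp (lam n * ((k : ℝ) + 1)))).tsum_eq]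
      apply tsum_congr
      intro i
      rw [← mul_assoc, ← Real.exp_add]
      congr 2
      ring
    simp only [key]
    have hlim : P n x = ∑' i : ℕ, if i = 0 then P n x else 0 := by
      rw [tsum_ite_eq]
    rw [hlim]
    refine tendsto_tsum_of_dominated_convergence
      (bound := fun i => Real.exp (lam n) * |Real.exp (-lam (i + n) * 1) * P (i + n) x|) ?_ ?_ ?_
    · exact (((summable_nat_add_iff n).mpr hs1).abs).mul_left _
    · intro i
      by_cases hi : i = 0
      · subst hi
        simp
      · simp only [hi, if_false]
        have hlt : 0 < lam (i + n) - lam n := sub_pos.mpr (hmono (by omega))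
        rw [← zero_mul (P (i + n) x)]
        refine Filter.Tendsto.mul_const _ ?_
        refine Real.tendsto_exp_atBot.comp ?_
        refine Filter.Tendsto.const_mul_atTop_of_neg (by linarith) ?_
        exact Filter.tendsto_atTop_add_const_right _ _ tendsto_natCast_atTop_atTop
    · refine Filter.Eventually.of_forall (fun k i => ?_)
      rw [Real.norm_eq_abs, abs_mul, abs_mul, ← mul_assoc, Real.abs_exp, Real.abs_exp,
        ← Real.exp_add]
      gcongr
      have : lam n ≤ lam (i + n) := hmono.monotone (by omega)
      have hk : (0 : ℝ) ≤ k := by positivity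
      nlinarith

/-- Measurability of components from measurability of the reproducing kernel. -/
lemma aux_comp_meas {M : Type*} [MeasurableSpace M] (μ : Measure M) (d : ℕ)
    (f : Fin d → M → ℝ)
    (hm : ∀ p, AEStronglyMeasurable (fun x => ∑ j, f j p * f j x) μ) (j : Fin d) :
    AEStronglyMeasurable (f j) μ := by
  let v : M → EuclideanSpace ℝ (Fin d) := fun x => WithLp.toLp 2 (fun j => f j x)
  let W := Submodule.span ℝ (Set.range v)
  have hW : ∀ w ∈ W, AEStronglyMeasurable (fun x => inner ℝ w (v x)) μ := by
    intro w hw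
    induction hw using Submodule.span_induction with
    | mem w hw =>
      obtain ⟨p, rfl⟩ := hw
      refine (hm p).congr (Filter.Eventually.of_forall fun x => ?_)
      simp [v, PiLp.inner_apply, mul_comm]
    | zero => simpa using aestronglyMeasurable_const
    | add a b _ _ ha hb =>
      simp only [inner_add_left]
      exact ha.add hb
    | smul c a _ ha =>
      simp only [inner_smul_left]
      exact ha.const_mul _
  have h := hW (W.starProjection (EuclideanSpace.single j 1)) (Submodule.starProjection_apply_mem _ _)
  refine h.congr (Filter.Eventually.of_forall fun x => ?_)
  have hv : v x ∈ W := Submodule.subset_span ⟨x, rfl⟩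
  change inner ℝ (W.starProjection (EuclideanSpace.single j 1)) (v x) = f j x
  rw [Submodule.inner_starProjection_left_eq_right, Submodule.starProjection_eq_self_iff.mpr hv]
  simp [v, EuclideanSpace.inner_single_left]

lemma aux_abs_zonal (d : ℕ) (a b : Fin d → ℝ) (ha : ∑ j, a j ^ 2 = (d : ℝ))
    (hb : ∑ j, b j ^ 2 = (d : ℝ)) : |∑ j, a j * b j| ≤ d := by
  have h1 : 0 ≤ ∑ j, (a j - b j) ^ 2 := Finset.sum_nonneg fun j _ => sq_nonneg _
  have h2 : 0 ≤ ∑ j, (a j + b j) ^ 2 := Finset.sum_nonneg fun j _ => sq_nonneg _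
  have e1 : ∑ j, (a j - b j) ^ 2 = ∑ j, a j ^ 2 + ∑ j, b j ^ 2 - 2 * ∑ j, a j * b j := by
    rw [Finset.mul_sum, ← Finset.sum_add_distrib, ← Finset.sum_sub_distrib]
    exact Finset.sum_congr rfl fun j _ => by ring
  have e2 : ∑ j, (a j + b j) ^ 2 = ∑ j, a j ^ 2 + ∑ j, b j ^ 2 + 2 * ∑ j, a j * b j := by
    rw [Finset.mul_sum, ← Finset.sum_add_distrib, ← Finset.sum_add_distrib]
    exact Finset.sum_congr rfl fun j _ => by ring
  rw [abs_le]
  constructor <;> linarith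

lemma aux_orth {M : Type*} [MeasurableSpace M] (μ : Measure M) {ι : Type*} [DecidableEq ι]
    (φ : ι → M → ℝ) (hL : ∀ a, MemLp (φ a) 2 μ) (hN : ∀ a, ∫ x, (φ a x) ^ 2 ∂μ = 1)
    (hO : ∀ a b, a ≠ b → ∫ x, φ a x * φ b x ∂μ = 0) (s : Finset ι) (c : ι → ℝ) :
    ∫ x, (∑ a ∈ s, c a * φ a x) ^ 2 ∂μ = ∑ a ∈ s, c a ^ 2 := by
  have hint : ∀ a b, Integrable (fun x => c a * c b * (φ a x * φ b x)) μ := fun a b =>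
    ((hL a).integrable_mul (hL b)).const_mul _
  have e : ∀ x, (∑ a ∈ s, c a * φ a x) ^ 2 =
      ∑ a ∈ s, ∑ b ∈ s, c a * c b * (φ a x * φ b x) := by
    intro x
    rw [sq, Finset.sum_mul_sum]
    exact Finset.sum_congr rfl fun a _ => Finset.sum_congr rfl fun b _ => by ring
  simp only [e]
  rw [integral_finsetSum _ (fun a _ => integrable_finsetSum _ fun b _ => hint a b)]
  refine Finset.sum_congr rfl fun a ha => ?_
  rw [integral_finsetSum _ (fun b _ => hint a b)]
  rw [Finset.sum_eq_single a]
  · rw [integral_const_mul]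
    have := hN a
    simp only [sq] at this ⊢
    rw [this, mul_one]
  · intro b _ hb
    rw [integral_const_mul, hO a b hb.symm, mul_zero]
  · exact fun h => absurd ha h

/-- **Tail bound for the heat-kernel truncation** (Lemma `tail-ineq`).
`M` is a compact connected Riemannian symmetric space of dimension `dM` and antipodal
dimension `dbar` with invariant probability measure `σM`; `Hk` is its heat kernel, with
Fourier decomposition in the orthonormal eigenfunctions `efn` of `−Δ_M`; `C_M` is the
constant from Donnelly's bound, the Weyl-law counting bound and the Nowak–Sjögren–Szarek
heat-kernel bounds.  Let `ε ∈ (0, 2^{−e})`, `η > 0`, and set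
`k_η := max(2 + 2 log₂(1/η), (d_M/2) log₂(d_M/(2ε²)) + d_M log₂log₂(d_M/(2ε²)))`.
Then for every `λ∞ ≥ 4^{k_η/d_M}` and every `p ∈ M`:
`‖H_p(·, ε²) − H^{λ∞}_p(·, ε²)‖²_{L²(M,σ^M)} ≤ C_M η²`. -/
theorem heat_kernel_truncation_tail_bound
    {M : Type*} [MetricSpace M] [CompactSpace M] [Nonempty M]
    [MeasurableSpace M] [BorelSpace M]
    (σM : Measure M) [IsProbabilityMeasure σM]
    (dM dbar : ℕ) (hdM : 1 ≤ dM)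
    (CM cM vM : ℝ) (hCM : 0 < CM) (hcM : 0 < cM) (hvM : 0 < vM)
    (Hk : M → M → ℝ → ℝ)
    -- the spectrum `0 = λ₀ < λ₁ < ⋯` of `−Δ_M`, with eigenspace dimensions `ddim i`
    (lam : ℕ → ℝ) (hlam0 : lam 0 = 0) (hlamMono : StrictMono lam)
    (ddim : ℕ → ℕ)
    -- an orthonormal system of eigenfunctions in `L²(M, σM)`
    (efn : (i : ℕ) → Fin (ddim i) → M → ℝ)
    (hNorm : ∀ i j, ∫ x, (efn i j x) ^ 2 ∂σM = 1)
    (hOrth : ∀ i i' : ℕ, ∀ (j : Fin (ddim i)) (j' : Fin (ddim i')),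
      (i ≠ i' ∨ (j : ℕ) ≠ (j' : ℕ)) → ∫ x, efn i j x * efn i' j' x ∂σM = 0)
    -- the pointwise trace identity `Σ_j φ_{λ,j}(p)² = d_λ` (Lemma `el1`)
    (hTrace : ∀ i : ℕ, ∀ p : M, ∑ j, (efn i j p) ^ 2 = (ddim i : ℝ))
    -- the Weyl-law counting bound on dyadic windows of eigenvalues
    (hWeyl : ∀ Λ : ℝ, 0 < Λ →
      (∑' i : ℕ, if Λ < lam i ∧ lam i ≤ (4 : ℝ) ^ ((1 : ℝ) / (dM : ℝ)) * Λ
        then (ddim i : ℝ) else 0) ≤ CM * Λ ^ ((dM : ℝ) / 2))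
    -- the Fourier decomposition of the heat kernel
    (hExpand : ∀ p x : M, ∀ t : ℝ, 0 < t →
      HasSum (fun i : ℕ => Real.exp (-lam i * t) * ∑ j, efn i j p * efn i j x) (Hk p x t))
    -- symmetry, semigroup property and stochastic completeness
    (hSymm : ∀ p x : M, ∀ t : ℝ, Hk p x t = Hk x p t)
    (hSemigroup : ∀ p q : M, ∀ t s : ℝ, 0 < t → 0 < s →
      ∫ x, Hk p x t * Hk x q s ∂σM = vM * Hk p q (t + s))
    (hComplete : ∀ p : M, ∀ t : ℝ, 0 < t → ∫ x, Hk p x t ∂σM = vM)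
    -- two-sided Gaussian bounds of Nowak–Sjögren–Szarek, defining `c_M, C_M`
    (hNowak : ∀ (p x : M), ∀ t ∈ Set.Ioo (0 : ℝ) 1,
      cM * Real.exp (-(dist x p) ^ 2 / (4 * t)) /
          ((t + diam (Set.univ : Set M) - dist x p) ^ (((dM : ℝ) - dbar - 1) / 2)
            * t ^ ((dM : ℝ) / 2)) ≤ Hk p x t ∧
      Hk p x t ≤ CM * Real.exp (-(dist x p) ^ 2 / (4 * t)) /
          ((t + diam (Set.univ : Set M) - dist x p) ^ (((dM : ℝ) - dbar - 1) / 2)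
            * t ^ ((dM : ℝ) / 2))) :
    ∀ ε : ℝ, 0 < ε → ε < (2 : ℝ) ^ (-(Real.exp 1)) → ∀ η : ℝ, 0 < η →
      ∀ Λ : ℝ,
        (4 : ℝ) ^ (max (2 + 2 * Real.logb 2 (1 / η))
            (((dM : ℝ) / 2) * Real.logb 2 ((dM : ℝ) / (2 * ε ^ 2))
              + (dM : ℝ) * Real.logb 2 (Real.logb 2 ((dM : ℝ) / (2 * ε ^ 2)))) / (dM : ℝ))
          ≤ Λ →
      ∀ p : M,
        (∫ x, (Hk p x (ε ^ 2) - truncatedHeatKernel lam ddim efn Λ p x (ε ^ 2)) ^ 2 ∂σM)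
          ≤ CM * η ^ 2 := by
  intro ε hε hε2 η hη Λ hΛ p
  obtain ⟨hpos, h1, h2⟩ := aux_numeric dM hdM ε hε hε2 η hη Λ hΛ
  have ht : 0 < ε ^ 2 := by positivity
  set t := ε ^ 2 with htdef
  clear_value t
  have hHm : ∀ q : M, ∀ s : ℝ, 0 < s → AEStronglyMeasurable (fun x => Hk q x s) σM := by
    intro q s hs
    by_contra hcon
    have := hComplete q s hs
    rw [integral_undef (fun hi => hcon hi.aestronglyMeasurable)] at this
    linarith
  have hPm : ∀ (i : ℕ) (q : M),
      AEStronglyMeasurable (fun x => ∑ j, efn i j q * efn i j x) σM := by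
    intro i q
    exact aux_zonal_meas σM lam hlamMono (fun i x => ∑ j, efn i j q * efn i j x)
      (fun x s => Hk q x s) (hHm q) (fun x s hs => hExpand q x s hs) i
  have hem : ∀ (i : ℕ) (j : Fin (ddim i)), AEStronglyMeasurable (efn i j) σM := fun i j =>
    aux_comp_meas σM (ddim i) (efn i) (hPm i) j
  have hL : ∀ a : (Σ i : ℕ, Fin (ddim i)), MemLp (efn a.1 a.2) 2 σM := by
    intro a
    rw [memLp_two_iff_integrable_sq (hem _ _)]
    by_contra hcon
    have := hNorm a.1 a.2
    rw [integral_undef hcon] at this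
    norm_num at this
  have hsum : Summable fun i => Real.exp (-lam i * t) * (ddim i : ℝ) := by
    have := (hExpand p p t ht).summable
    simpa only [← sq, hTrace] using this
  have hwin := aux_windows dM hdM CM t η Λ hCM ht hη lam ddim hsum hWeyl hpos h1 h2
  have habs : ∀ i x, |∑ j, efn i j p * efn i j x| ≤ (ddim i : ℝ) := fun i x =>
    aux_abs_zonal (ddim i) _ _ (hTrace i p) (hTrace i x)
  set c : ℕ → ℝ := fun i => if Λ < lam i then Real.exp (-lam i * t) else 0 with hc
  have hc0 : ∀ i, 0 ≤ c i := fun i => by simp only [hc]; split_ifs <;> positivity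
  have hcle : ∀ i, c i ≤ Real.exp (-lam i * t) := fun i => by
    simp only [hc]; split_ifs
    · exact le_rfl
    · positivity
  have htail : ∀ x, HasSum (fun i => c i * ∑ j, efn i j p * efn i j x)
      (Hk p x t - truncatedHeatKernel lam ddim efn Λ p x t) := by
    intro x
    have hE := hExpand p x t ht
    have hT : Summable fun i : ℕ =>
        if lam i ≤ Λ then Real.exp (-lam i * t) * ∑ j, efn i j p * efn i j x else 0 := by
      refine Summable.of_norm_bounded hE.summable.abs (fun i => ?_)
      split_ifs
      · exact le_rfl
      · rw [norm_zero]; exact abs_nonneg _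
    have hS := hE.sub hT.hasSum
    refine Eq.mp (congrArg (fun g => HasSum g _) (funext fun i => ?_)) hS
    simp only [hc]
    by_cases h : lam i ≤ Λ
    · simp [h, not_lt.mpr h]
    · simp [h, not_le.mp h]
  have hconv : Filter.Tendsto
      (fun N : ℕ => ∫ x, (∑ i ∈ Finset.range N, c i * ∑ j, efn i j p * efn i j x) ^ 2 ∂σM)
      Filter.atTop
      (nhds (∫ x, (Hk p x t - truncatedHeatKernel lam ddim efn Λ p x t) ^ 2 ∂σM)) := by
    refine tendsto_integral_of_dominated_convergence
      (fun _ => (∑' i, Real.exp (-lam i * t) * (ddim i : ℝ)) ^ 2) ?_ (integrable_const _) ?_ ?_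
    · intro N
      refine AEStronglyMeasurable.pow ?_ 2
      exact Finset.aestronglyMeasurable_fun_sum _ (fun i _ => (hPm i p).const_mul _)
    · intro N
      refine Filter.Eventually.of_forall fun x => ?_
      rw [norm_pow]
      gcongr
      calc _ ≤ ∑ i ∈ Finset.range N, ‖c i * ∑ j, efn i j p * efn i j x‖ := norm_sum_le _ _
        _ ≤ ∑ i ∈ Finset.range N, Real.exp (-lam i * t) * (ddim i : ℝ) := by
            refine Finset.sum_le_sum fun i _ => ?_
            rw [norm_mul, Real.norm_eq_abs, Real.norm_eq_abs, abs_of_nonneg (hc0 i)]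
            exact mul_le_mul (hcle i) (habs i x) (abs_nonneg _) (by positivity)
        _ ≤ _ := hsum.sum_le_tsum _ (fun i _ => by positivity)
    · exact Filter.Eventually.of_forall fun x => ((htail x).tendsto_sum_nat.pow 2)
  refine le_of_tendsto' hconv (fun N => ?_)
  refine le_trans (le_of_eq ?_) (hwin (Finset.range N))
  have e1 : ∀ x, (∑ i ∈ Finset.range N, c i * ∑ j, efn i j p * efn i j x) =
      ∑ a ∈ (Finset.range N).sigma (fun i => (Finset.univ : Finset (Fin (ddim i)))),
        (c a.1 * efn a.1 a.2 p) * efn a.1 a.2 x := by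
    intro x
    rw [Finset.sum_sigma]
    refine Finset.sum_congr rfl fun i _ => ?_
    rw [Finset.mul_sum]
    exact Finset.sum_congr rfl fun j _ => by ring
  simp only [e1]
  rw [aux_orth σM (fun a : (Σ i : ℕ, Fin (ddim i)) => efn a.1 a.2) hL (fun a => hNorm _ _) ?_ _
    (fun a => c a.1 * efn a.1 a.2 p), Finset.sum_sigma]
  · refine Finset.sum_congr rfl fun i _ => ?_
    simp only [mul_pow]
    rw [← Finset.mul_sum, hTrace]
    simp only [hc]
    split_ifs <;> simp
  · rintro ⟨i, j⟩ ⟨i', j'⟩ hne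
    apply hOrth
    by_contra hcon
    push Not at hcon
    obtain ⟨hi, hj⟩ := hcon
    subst hi
    have hj2 : j = j' := Fin.ext hj
    subst hj2
    exact hne rfl
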